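/- Every 2-local derivation of the algebra W₂ is a derivation (in particular, it is linear). -/

import Mathlib

set_option maxSynthPendingDepth 3

/-- The 2-dimensional vector space `V₂ = F²`, with standard basis `v₁ = (1,0)`, `v₂ = (0,1)`. -/
abbrev V2 (F : Type*) [Field F] := Fin 2 → F

/-- The fixed vector `v₁` (the first standard basis vector of `V₂`). -/
noncomputable def v1 (F : Type*) [Field F] : V2 F := Pi.single 0 1

/-- `W(2)`: the space of all bilinear multiplications on `V₂`. -/
abbrev Wtwo (F : Type*) [Field F] := V2 F →ₗ[F] V2 F →ₗ[F] V2 F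

variable {F : Type*} [Field F]

/-- The Kantor product on `W(2)`:
`(A·B)(x,y) = A(v₁, B(x,y)) − B(A(v₁,x), y) − B(x, A(v₁,y))`. -/
noncomputable def wmul (A B : Wtwo F) : Wtwo F :=
  LinearMap.mk₂ F
    (fun x y => A (v1 F) (B x y) - B (A (v1 F) x) y - B x (A (v1 F) y))
    (fun x x' y => by simp only [map_add, LinearMap.add_apply]; abel)
    (fun c x y => by simp only [map_smul, LinearMap.smul_apply, smul_sub])
    (fun x y y' => by simp only [map_add, LinearMap.add_apply]; abel)
    (fun c x y => by simp only [map_smul, LinearMap.smul_apply, smul_sub])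

/-- The multiplication `α^k_{i,j}` determined by `α^k_{i,j}(v_t, v_l) = δ_{it} δ_{jl} v_k`
(indices `0, 1` correspond to `1, 2` in the paper). -/
noncomputable def alph (k i j : Fin 2) : Wtwo F :=
  LinearMap.mk₂ F
    (fun x y => (x i * y j) • (Pi.single k 1 : V2 F))
    (fun x x' y => by simp [add_mul, add_smul])
    (fun c x y => by simp [smul_smul, mul_assoc])
    (fun x y y' => by simp [mul_add, add_smul])
    (fun c x y => by simp [smul_smul]; ring_nf)

noncomputable def e1 (F : Type*) [Field F] : Wtwo F := alph 0 0 0 - alph 1 0 1 - alph 1 1 0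

noncomputable def e2 (F : Type*) [Field F] : Wtwo F := alph 1 0 0

noncomputable def e3 (F : Type*) [Field F] : Wtwo F := alph 1 1 1 - alph 0 0 1 - alph 0 1 0

noncomputable def e4 (F : Type*) [Field F] : Wtwo F := alph 0 1 1

noncomputable def e5 (F : Type*) [Field F] : Wtwo F := (2 : F) • alph 0 0 0 + alph 1 0 1 + alph 1 1 0

noncomputable def e6 (F : Type*) [Field F] : Wtwo F := (2 : F) • alph 1 1 1 + alph 0 0 1 + alph 0 1 0


theorem wmul_add_left (A A' B : Wtwo F) : wmul (A + A') B = wmul A B + wmul A' B := by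
  apply LinearMap.ext; intro x; apply LinearMap.ext; intro y
  simp [wmul]; abel

theorem wmul_smul_left (c : F) (A B : Wtwo F) : wmul (c • A) B = c • wmul A B := by
  apply LinearMap.ext; intro x; apply LinearMap.ext; intro y
  simp [wmul, smul_sub]

theorem wmul_add_right (A B B' : Wtwo F) : wmul A (B + B') = wmul A B + wmul A B' := by
  apply LinearMap.ext; intro x; apply LinearMap.ext; intro y
  simp [wmul]; abel

theorem wmul_smul_right (c : F) (A B : Wtwo F) : wmul A (c • B) = c • wmul A B := by
  apply LinearMap.ext; intro x; apply LinearMap.ext; intro y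
  simp [wmul, smul_sub]

theorem wmul_sub_left (A A' B : Wtwo F) : wmul (A - A') B = wmul A B - wmul A' B := by
  apply LinearMap.ext; intro x; apply LinearMap.ext; intro y
  simp [wmul]; abel

theorem wmul_sub_right (A B B' : Wtwo F) : wmul A (B - B') = wmul A B - wmul A B' := by
  apply LinearMap.ext; intro x; apply LinearMap.ext; intro y
  simp [wmul]; abel

theorem wmul_alph (k i j k' i' j' : Fin 2) :
    wmul (alph k i j) (alph k' i' j' : Wtwo F) =
      (if i = 0 then (1:F) else 0) •
        ((if j = k' then (1:F) else 0) • alph k i' j'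
          - (if k = i' then (1:F) else 0) • alph k' j j'
          - (if k = j' then (1:F) else 0) • alph k' i' j) := by
  apply LinearMap.ext; intro x; apply LinearMap.ext; intro y
  funext m
  simp [wmul, alph, v1, Pi.single_apply]
  split_ifs <;> simp_all <;> try ring

theorem mul_e4_left (B : Wtwo F) : wmul (e4 F) B = 0 := by
  apply LinearMap.ext; intro x; apply LinearMap.ext; intro y
  simp [wmul, e4, alph, v1, Pi.single_apply]

theorem wmul_left_eq (A A' B : Wtwo F) (h : A (v1 F) = A' (v1 F)) : wmul A B = wmul A' B := by
  apply LinearMap.ext; intro x; apply LinearMap.ext; intro y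
  simp [wmul, h]

theorem red_e1 (B : Wtwo F) :
    wmul (e1 F) B = wmul (alph 0 0 0) B - wmul (alph 1 0 1) B := by
  rw [wmul_left_eq (e1 F) (alph 0 0 0 - alph 1 0 1) B, wmul_sub_left]
  apply LinearMap.ext; intro z; funext m
  fin_cases m <;> simp [e1, alph, v1, Pi.single_apply]

theorem red_e3 (B : Wtwo F) : wmul (e3 F) B = -wmul (alph 0 0 1) B := by
  have h : wmul (e3 F) B = wmul ((-1 : F) • alph 0 0 1) B := by
    apply wmul_left_eq
    apply LinearMap.ext; intro z; funext m
    fin_cases m <;> simp [e3, alph, v1, Pi.single_apply]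
  rw [h, wmul_smul_left]; module

theorem red_e5 (B : Wtwo F) :
    wmul (e5 F) B = (2 : F) • wmul (alph 0 0 0) B + wmul (alph 1 0 1) B := by
  rw [wmul_left_eq (e5 F) ((2 : F) • alph 0 0 0 + alph 1 0 1) B, wmul_add_left, wmul_smul_left]
  apply LinearMap.ext; intro z; funext m
  fin_cases m <;> simp [e5, alph, v1, Pi.single_apply]

theorem red_e6 (B : Wtwo F) : wmul (e6 F) B = wmul (alph 0 0 1) B := by
  apply wmul_left_eq
  apply LinearMap.ext; intro z; funext m
  fin_cases m <;> simp [e6, alph, v1, Pi.single_apply]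

theorem mul_L00_e1 : wmul (alph 0 0 0) (e1 F) = ((-1 : F)) • e1 F := by
  simp only [e1, e2, e3, e4, e5, e6, wmul_sub_right, wmul_add_right, wmul_smul_right, wmul_alph,
    Fin.reduceEq, reduceIte, one_smul, zero_smul, smul_zero, sub_zero, zero_sub,
    smul_sub, smul_add, smul_smul, neg_neg, smul_neg, neg_zero, sub_self, add_zero, zero_add]
  try module

theorem mul_L00_e2 : wmul (alph 0 0 0) (e2 F) = ((-2 : F)) • e2 F := by
  simp only [e1, e2, e3, e4, e5, e6, wmul_sub_right, wmul_add_right, wmul_smul_right, wmul_alph,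
    Fin.reduceEq, reduceIte, one_smul, zero_smul, smul_zero, sub_zero, zero_sub,
    smul_sub, smul_add, smul_smul, neg_neg, smul_neg, neg_zero, sub_self, add_zero, zero_add]
  try module

theorem mul_L00_e3 : wmul (alph 0 0 0) (e3 F) = 0 := by
  simp only [e1, e2, e3, e4, e5, e6, wmul_sub_right, wmul_add_right, wmul_smul_right, wmul_alph,
    Fin.reduceEq, reduceIte, one_smul, zero_smul, smul_zero, sub_zero, zero_sub,
    smul_sub, smul_add, smul_smul, neg_neg, smul_neg, neg_zero, sub_self, add_zero, zero_add]
  try module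

theorem mul_L00_e4 : wmul (alph 0 0 0) (e4 F) = ((1 : F)) • e4 F := by
  simp only [e1, e2, e3, e4, e5, e6, wmul_sub_right, wmul_add_right, wmul_smul_right, wmul_alph,
    Fin.reduceEq, reduceIte, one_smul, zero_smul, smul_zero, sub_zero, zero_sub,
    smul_sub, smul_add, smul_smul, neg_neg, smul_neg, neg_zero, sub_self, add_zero, zero_add]
  try module

theorem mul_L00_e5 : wmul (alph 0 0 0) (e5 F) = ((-1 : F)) • e5 F := by
  simp only [e1, e2, e3, e4, e5, e6, wmul_sub_right, wmul_add_right, wmul_smul_right, wmul_alph,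
    Fin.reduceEq, reduceIte, one_smul, zero_smul, smul_zero, sub_zero, zero_sub,
    smul_sub, smul_add, smul_smul, neg_neg, smul_neg, neg_zero, sub_self, add_zero, zero_add]
  try module

theorem mul_L00_e6 : wmul (alph 0 0 0) (e6 F) = 0 := by
  simp only [e1, e2, e3, e4, e5, e6, wmul_sub_right, wmul_add_right, wmul_smul_right, wmul_alph,
    Fin.reduceEq, reduceIte, one_smul, zero_smul, smul_zero, sub_zero, zero_sub,
    smul_sub, smul_add, smul_smul, neg_neg, smul_neg, neg_zero, sub_self, add_zero, zero_add]
  try module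

theorem mul_L01_e1 : wmul (alph 0 0 1) (e1 F) = ((2 : F)) • e3 F := by
  simp only [e1, e2, e3, e4, e5, e6, wmul_sub_right, wmul_add_right, wmul_smul_right, wmul_alph,
    Fin.reduceEq, reduceIte, one_smul, zero_smul, smul_zero, sub_zero, zero_sub,
    smul_sub, smul_add, smul_smul, neg_neg, smul_neg, neg_zero, sub_self, add_zero, zero_add]
  try module

theorem mul_L01_e2 : wmul (alph 0 0 1) (e2 F) = ((1 : F)) • e1 F := by
  simp only [e1, e2, e3, e4, e5, e6, wmul_sub_right, wmul_add_right, wmul_smul_right, wmul_alph,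
    Fin.reduceEq, reduceIte, one_smul, zero_smul, smul_zero, sub_zero, zero_sub,
    smul_sub, smul_add, smul_smul, neg_neg, smul_neg, neg_zero, sub_self, add_zero, zero_add]
  try module

theorem mul_L01_e3 : wmul (alph 0 0 1) (e3 F) = ((3 : F)) • e4 F := by
  simp only [e1, e2, e3, e4, e5, e6, wmul_sub_right, wmul_add_right, wmul_smul_right, wmul_alph,
    Fin.reduceEq, reduceIte, one_smul, zero_smul, smul_zero, sub_zero, zero_sub,
    smul_sub, smul_add, smul_smul, neg_neg, smul_neg, neg_zero, sub_self, add_zero, zero_add]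
  try module

theorem mul_L01_e4 : wmul (alph 0 0 1) (e4 F) = 0 := by
  simp only [e1, e2, e3, e4, e5, e6, wmul_sub_right, wmul_add_right, wmul_smul_right, wmul_alph,
    Fin.reduceEq, reduceIte, one_smul, zero_smul, smul_zero, sub_zero, zero_sub,
    smul_sub, smul_add, smul_smul, neg_neg, smul_neg, neg_zero, sub_self, add_zero, zero_add]
  try module

theorem mul_L01_e5 : wmul (alph 0 0 1) (e5 F) = ((-1 : F)) • e6 F := by
  simp only [e1, e2, e3, e4, e5, e6, wmul_sub_right, wmul_add_right, wmul_smul_right, wmul_alph,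
    Fin.reduceEq, reduceIte, one_smul, zero_smul, smul_zero, sub_zero, zero_sub,
    smul_sub, smul_add, smul_smul, neg_neg, smul_neg, neg_zero, sub_self, add_zero, zero_add]
  try module

theorem mul_L01_e6 : wmul (alph 0 0 1) (e6 F) = 0 := by
  simp only [e1, e2, e3, e4, e5, e6, wmul_sub_right, wmul_add_right, wmul_smul_right, wmul_alph,
    Fin.reduceEq, reduceIte, one_smul, zero_smul, smul_zero, sub_zero, zero_sub,
    smul_sub, smul_add, smul_smul, neg_neg, smul_neg, neg_zero, sub_self, add_zero, zero_add]
  try module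

theorem mul_L10_e1 : wmul (e2 F) (e1 F) = ((3 : F)) • e2 F := by
  simp only [e1, e2, e3, e4, e5, e6, wmul_sub_right, wmul_add_right, wmul_smul_right, wmul_alph,
    Fin.reduceEq, reduceIte, one_smul, zero_smul, smul_zero, sub_zero, zero_sub,
    smul_sub, smul_add, smul_smul, neg_neg, smul_neg, neg_zero, sub_self, add_zero, zero_add]
  try module

theorem mul_L10_e2 : wmul (e2 F) (e2 F) = 0 := by
  simp only [e1, e2, e3, e4, e5, e6, wmul_sub_right, wmul_add_right, wmul_smul_right, wmul_alph,
    Fin.reduceEq, reduceIte, one_smul, zero_smul, smul_zero, sub_zero, zero_sub,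
    smul_sub, smul_add, smul_smul, neg_neg, smul_neg, neg_zero, sub_self, add_zero, zero_add]
  try module

theorem mul_L10_e3 : wmul (e2 F) (e3 F) = ((2 : F)) • e1 F := by
  simp only [e1, e2, e3, e4, e5, e6, wmul_sub_right, wmul_add_right, wmul_smul_right, wmul_alph,
    Fin.reduceEq, reduceIte, one_smul, zero_smul, smul_zero, sub_zero, zero_sub,
    smul_sub, smul_add, smul_smul, neg_neg, smul_neg, neg_zero, sub_self, add_zero, zero_add]
  try module

theorem mul_L10_e4 : wmul (e2 F) (e4 F) = ((1 : F)) • e3 F := by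
  simp only [e1, e2, e3, e4, e5, e6, wmul_sub_right, wmul_add_right, wmul_smul_right, wmul_alph,
    Fin.reduceEq, reduceIte, one_smul, zero_smul, smul_zero, sub_zero, zero_sub,
    smul_sub, smul_add, smul_smul, neg_neg, smul_neg, neg_zero, sub_self, add_zero, zero_add]
  try module

theorem mul_L10_e5 : wmul (e2 F) (e5 F) = 0 := by
  simp only [e1, e2, e3, e4, e5, e6, wmul_sub_right, wmul_add_right, wmul_smul_right, wmul_alph,
    Fin.reduceEq, reduceIte, one_smul, zero_smul, smul_zero, sub_zero, zero_sub,
    smul_sub, smul_add, smul_smul, neg_neg, smul_neg, neg_zero, sub_self, add_zero, zero_add]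
  try module

theorem mul_L10_e6 : wmul (e2 F) (e6 F) = ((-1 : F)) • e5 F := by
  simp only [e1, e2, e3, e4, e5, e6, wmul_sub_right, wmul_add_right, wmul_smul_right, wmul_alph,
    Fin.reduceEq, reduceIte, one_smul, zero_smul, smul_zero, sub_zero, zero_sub,
    smul_sub, smul_add, smul_smul, neg_neg, smul_neg, neg_zero, sub_self, add_zero, zero_add]
  try module

theorem mul_L11_e1 : wmul (alph 1 0 1) (e1 F) = 0 := by
  simp only [e1, e2, e3, e4, e5, e6, wmul_sub_right, wmul_add_right, wmul_smul_right, wmul_alph,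
    Fin.reduceEq, reduceIte, one_smul, zero_smul, smul_zero, sub_zero, zero_sub,
    smul_sub, smul_add, smul_smul, neg_neg, smul_neg, neg_zero, sub_self, add_zero, zero_add]
  try module

theorem mul_L11_e2 : wmul (alph 1 0 1) (e2 F) = ((1 : F)) • e2 F := by
  simp only [e1, e2, e3, e4, e5, e6, wmul_sub_right, wmul_add_right, wmul_smul_right, wmul_alph,
    Fin.reduceEq, reduceIte, one_smul, zero_smul, smul_zero, sub_zero, zero_sub,
    smul_sub, smul_add, smul_smul, neg_neg, smul_neg, neg_zero, sub_self, add_zero, zero_add]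
  try module

theorem mul_L11_e3 : wmul (alph 1 0 1) (e3 F) = ((-1 : F)) • e3 F := by
  simp only [e1, e2, e3, e4, e5, e6, wmul_sub_right, wmul_add_right, wmul_smul_right, wmul_alph,
    Fin.reduceEq, reduceIte, one_smul, zero_smul, smul_zero, sub_zero, zero_sub,
    smul_sub, smul_add, smul_smul, neg_neg, smul_neg, neg_zero, sub_self, add_zero, zero_add]
  try module

theorem mul_L11_e4 : wmul (alph 1 0 1) (e4 F) = ((-2 : F)) • e4 F := by
  simp only [e1, e2, e3, e4, e5, e6, wmul_sub_right, wmul_add_right, wmul_smul_right, wmul_alph,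
    Fin.reduceEq, reduceIte, one_smul, zero_smul, smul_zero, sub_zero, zero_sub,
    smul_sub, smul_add, smul_smul, neg_neg, smul_neg, neg_zero, sub_self, add_zero, zero_add]
  try module

theorem mul_L11_e5 : wmul (alph 1 0 1) (e5 F) = 0 := by
  simp only [e1, e2, e3, e4, e5, e6, wmul_sub_right, wmul_add_right, wmul_smul_right, wmul_alph,
    Fin.reduceEq, reduceIte, one_smul, zero_smul, smul_zero, sub_zero, zero_sub,
    smul_sub, smul_add, smul_smul, neg_neg, smul_neg, neg_zero, sub_self, add_zero, zero_add]
  try module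

theorem mul_L11_e6 : wmul (alph 1 0 1) (e6 F) = ((-1 : F)) • e6 F := by
  simp only [e1, e2, e3, e4, e5, e6, wmul_sub_right, wmul_add_right, wmul_smul_right, wmul_alph,
    Fin.reduceEq, reduceIte, one_smul, zero_smul, smul_zero, sub_zero, zero_sub,
    smul_sub, smul_add, smul_smul, neg_neg, smul_neg, neg_zero, sub_self, add_zero, zero_add]
  try module

/-- `W2` as a subspace of `W(2)`. -/
noncomputable def W2 (F : Type*) [Field F] : Submodule F (Wtwo F) :=
  Submodule.span F {e1 F, e2 F, e3 F, e4 F, e5 F, e6 F}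

/-- The Kantor product, as a bilinear map. -/
noncomputable def wmulL (F : Type*) [Field F] : Wtwo F →ₗ[F] Wtwo F →ₗ[F] Wtwo F :=
  LinearMap.mk₂ F wmul wmul_add_left wmul_smul_left wmul_add_right wmul_smul_right

set_option maxHeartbeats 2000000 in
theorem W2_mul_mem {x y : Wtwo F} (hx : x ∈ W2 F) (hy : y ∈ W2 F) :
    wmul x y ∈ W2 F := by
  have h2 : Submodule.map₂ (wmulL F) (W2 F) (W2 F) ≤ W2 F := by
    rw [W2, Submodule.map₂_span_span, Submodule.span_le]
    rintro z ⟨a, ha, b, hb, rfl⟩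
    simp only [Set.mem_insert_iff, Set.mem_singleton_iff] at ha hb
    have m1 : e1 F ∈ W2 F := Submodule.subset_span (by simp)
    have m2 : e2 F ∈ W2 F := Submodule.subset_span (by simp)
    have m3 : e3 F ∈ W2 F := Submodule.subset_span (by simp)
    have m4 : e4 F ∈ W2 F := Submodule.subset_span (by simp)
    have m5 : e5 F ∈ W2 F := Submodule.subset_span (by simp)
    have m6 : e6 F ∈ W2 F := Submodule.subset_span (by simp)
    rcases ha with rfl | rfl | rfl | rfl | rfl | rfl <;> rcases hb with rfl | rfl | rfl | rfl | rfl | rfl <;>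
      simp only [wmulL, LinearMap.mk₂_apply, red_e1, red_e3, red_e5, red_e6, mul_L00_e1, mul_L00_e2, mul_L00_e3, mul_L00_e4, mul_L00_e5, mul_L00_e6, mul_L01_e1, mul_L01_e2, mul_L01_e3, mul_L01_e4, mul_L01_e5, mul_L01_e6, mul_L10_e1, mul_L10_e2, mul_L10_e3, mul_L10_e4, mul_L10_e5, mul_L10_e6, mul_L11_e1, mul_L11_e2, mul_L11_e3, mul_L11_e4, mul_L11_e5, mul_L11_e6, mul_e4_left,
        smul_smul, smul_zero, neg_zero, sub_zero, zero_sub, zero_add, add_zero, smul_neg,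
        neg_neg, sub_self] <;>
      (repeat' first
        | exact Submodule.zero_mem _
        | exact m1 | exact m2 | exact m3 | exact m4 | exact m5 | exact m6
        | apply Submodule.neg_mem
        | apply Submodule.sub_mem
        | apply Submodule.add_mem
        | apply Submodule.smul_mem)
  exact h2 (Submodule.apply_mem_map₂ _ hx hy)

/-- The product on `W2` (the Kantor product, which leaves `W2` invariant). -/
noncomputable def W2mul (x y : W2 F) : W2 F :=
  ⟨wmul x y, W2_mul_mem x.2 y.2⟩

/-- A derivation of the algebra `W2`. -/
def IsDerivationW2 (D : W2 F →ₗ[F] W2 F) : Prop :=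
  ∀ x y : W2 F, D (W2mul x y) = W2mul (D x) y + W2mul x (D y)

theorem mem_W2_iff {A : Wtwo F} : A ∈ W2 F ↔ ∃ a b c d e f : F,
    A = a • e1 F + b • e2 F + c • e3 F + d • e4 F + e • e5 F + f • e6 F := by
  simp only [W2, Submodule.mem_span_insert, Submodule.mem_span_singleton]
  constructor
  · rintro ⟨a, _, ⟨b, _, ⟨c, _, ⟨d, _, ⟨e, _, ⟨f, rfl⟩, rfl⟩, rfl⟩, rfl⟩, rfl⟩, rfl⟩
    exact ⟨a, b, c, d, e, f, by module⟩
  · rintro ⟨a, b, c, d, e, f, rfl⟩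
    exact ⟨a, _, ⟨b, _, ⟨c, _, ⟨d, _, ⟨e, _, ⟨f, rfl⟩, rfl⟩, rfl⟩, rfl⟩, rfl⟩, by module⟩

theorem e2_ne_zero : e2 F ≠ 0 := by
  intro h
  have := congrFun (LinearMap.congr_fun₂ h (Pi.single 0 1) (Pi.single 0 1)) 1
  simp [e2, alph] at this

/-- The elements of `W2` annihilating `e2` from both sides are the multiples of `e2`. -/
theorem exists_eq_smul_e2 [CharZero F] {A : Wtwo F} (hA : A ∈ W2 F)
    (hl : wmul (e2 F) A = 0) (hr : wmul A (e2 F) = 0) : ∃ p : F, A = p • e2 F := by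
  obtain ⟨a, b, c, d, e, f, rfl⟩ := mem_W2_iff.1 hA
  have coord (i j k : Fin 2) {B : Wtwo F} (h : B = 0) :
      B (Pi.single i 1) (Pi.single j 1) k = 0 := by simp [h]
  simp only [wmul_add_right, wmul_smul_right, mul_L10_e1, mul_L10_e2, mul_L10_e3, mul_L10_e4,
    mul_L10_e5, mul_L10_e6] at hl
  simp only [wmul_add_left, wmul_smul_left, red_e1, red_e3, red_e5, red_e6, mul_L10_e2,
    mul_L00_e2, mul_L01_e2, mul_L11_e2, mul_e4_left] at hr
  have l2 := coord 0 0 1 hl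
  have l3 := coord 0 1 0 hl
  have l4 := coord 0 1 1 hl
  have r1 := coord 0 0 0 hr
  have r2 := coord 0 0 1 hr
  simp [e1, e2, e3, e5, alph] at l2 l3 l4 r1 r2
  have eq_zero {t : F} (h : 3 * t = 0) : t = 0 := (mul_eq_zero.1 h).resolve_left three_ne_zero
  have hc : c = 0 := eq_zero (by linear_combination -l4 - r1)
  have he : e = 0 := eq_zero (by linear_combination -r2 - 3 * l2)
  have hf : f = 0 := by linear_combination r1 + hc
  exact ⟨b, by simp [l2, l3, hc, he, hf]⟩

theorem wmul_e1_e2 : wmul (e1 F) (e2 F) = (-3 : F) • e2 F := by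
  rw [red_e1, mul_L00_e2, mul_L11_e2]; module

/-- Apart from the multiples of `e2`, no eigenvector of left multiplication by `e1`
annihilates `e2` from both sides. -/
theorem eq_zero_of_wmul_e1_eq_smul [CharZero F] {A : Wtwo F} (hA : A ∈ W2 F)
    (hl : wmul (e2 F) A = 0) (hr : wmul A (e2 F) = 0) {c : F} (hc : c ≠ -3)
    (h : wmul (e1 F) A = c • A) : A = 0 := by
  obtain ⟨p, rfl⟩ := exists_eq_smul_e2 hA hl hr
  rw [wmul_smul_right, wmul_e1_e2, ← sub_eq_zero, smul_smul, smul_smul, ← sub_smul,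
    smul_eq_zero_iff_left e2_ne_zero] at h
  have : p = 0 := by
    have h' : (c - -3) * p = 0 := by linear_combination -h
    exact (mul_eq_zero.1 h').resolve_left (sub_ne_zero.2 hc)
  simp [this]

theorem IsDerivationW2.sub {D D' : W2 F →ₗ[F] W2 F} (hD : IsDerivationW2 D)
    (hD' : IsDerivationW2 D') : IsDerivationW2 (D - D') := by
  intro x y
  apply Subtype.ext
  have h := congrArg Subtype.val (hD x y)
  have h' := congrArg Subtype.val (hD' x y)
  simp only [W2mul, Submodule.coe_add] at h h'
  simp only [W2mul, LinearMap.sub_apply, Submodule.coe_add, Submodule.coe_sub, wmul_sub_left,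
    wmul_sub_right, h, h']
  abel

theorem IsDerivationW2.smul_eq {D : W2 F →ₗ[F] W2 F} (hD : IsDerivationW2 D) (x y : W2 F)
    (c : F) (z : W2 F) (h : wmul (x : Wtwo F) y = c • (z : Wtwo F)) :
    c • (D z : Wtwo F) = wmul (D x : Wtwo F) y + wmul (x : Wtwo F) (D y) := by
  have hxy : W2mul x y = c • z := Subtype.ext h
  have := hD x y
  rw [hxy, map_smul] at this
  exact congrArg Subtype.val this

/-- A derivation of `W2` vanishing at `e2` is zero. -/
theorem IsDerivationW2.eq_zero [CharZero F] {D : W2 F →ₗ[F] W2 F} (hD : IsDerivationW2 D)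
    {w : W2 F} (hw : (w : Wtwo F) = e2 F) (h2 : D w = 0) : D = 0 := by
  have h2' : (D w : Wtwo F) = 0 := by simp [h2]
  have zl (B : Wtwo F) : wmul 0 B = 0 := by simpa using wmul_smul_left 0 0 B
  have zr (B : Wtwo F) : wmul B 0 = 0 := by simpa using wmul_smul_right 0 B 0
  obtain ⟨x1, hx1⟩ : ∃ x : W2 F, (x : Wtwo F) = e1 F :=
    ⟨⟨e1 F, Submodule.subset_span (by simp)⟩, rfl⟩
  obtain ⟨x3, hx3⟩ : ∃ x : W2 F, (x : Wtwo F) = e3 F :=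
    ⟨⟨e3 F, Submodule.subset_span (by simp)⟩, rfl⟩
  obtain ⟨x4, hx4⟩ : ∃ x : W2 F, (x : Wtwo F) = e4 F :=
    ⟨⟨e4 F, Submodule.subset_span (by simp)⟩, rfl⟩
  obtain ⟨x5, hx5⟩ : ∃ x : W2 F, (x : Wtwo F) = e5 F :=
    ⟨⟨e5 F, Submodule.subset_span (by simp)⟩, rfl⟩
  obtain ⟨x6, hx6⟩ : ∃ x : W2 F, (x : Wtwo F) = e6 F :=
    ⟨⟨e6 F, Submodule.subset_span (by simp)⟩, rfl⟩
  have d1 : (D x1 : Wtwo F) = 0 := by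
    have l := hD.smul_eq w x1 3 w (by rw [hw, hx1, mul_L10_e1])
    have r := hD.smul_eq x1 w (-3) w (by rw [hw, hx1, wmul_e1_e2])
    have s := hD.smul_eq x1 x1 (-1) x1 (by rw [hx1, red_e1, mul_L00_e1, mul_L11_e1, sub_zero])
    simp only [hw, hx1, h2', zl, zr, smul_zero, zero_add, add_zero] at l r s
    obtain ⟨p, hp⟩ := exists_eq_smul_e2 (D x1).2 l.symm r.symm
    rw [hp, wmul_smul_left, wmul_smul_right, mul_L10_e1, wmul_e1_e2] at s
    rw [hp, ← neg_eq_zero]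
    calc -(p • e2 F) = (-1 : F) • p • e2 F := by module
      _ = 0 := by rw [s]; module
  have kill (x y z : W2 F) (a b c : F) (hc : c ≠ -3)
      (hl : wmul (e2 F) x = a • (y : Wtwo F)) (hr : wmul (x : Wtwo F) (e2 F) = b • (z : Wtwo F))
      (h : wmul (e1 F) x = c • (x : Wtwo F)) (hy : (D y : Wtwo F) = 0)
      (hz : (D z : Wtwo F) = 0) : (D x : Wtwo F) = 0 := by
    have l := hD.smul_eq w x a y (by rw [hw, hl])
    have r := hD.smul_eq x w b z (by rw [hw, hr])
    have s := hD.smul_eq x1 x c x (by rw [hx1, h])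
    simp only [hw, hx1, h2', d1, hy, hz, zl, zr, smul_zero, zero_add, add_zero] at l r s
    exact eq_zero_of_wmul_e1_eq_smul (D x).2 l.symm r.symm hc s.symm
  have d5 : (D x5 : Wtwo F) = 0 := by
    refine kill x5 w w 0 (-3) (-1) (by norm_num) ?_ ?_ ?_ h2' h2'
    · rw [hx5, mul_L10_e5, zero_smul]
    · rw [hx5, hw, red_e5, mul_L00_e2, mul_L11_e2]; module
    · rw [hx5, red_e1, mul_L00_e5, mul_L11_e5]; module
  have d3 : (D x3 : Wtwo F) = 0 := by
    refine kill x3 x1 x1 2 (-1) 1 (by norm_num) ?_ ?_ ?_ d1 d1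
    · rw [hx3, hx1, mul_L10_e3]
    · rw [hx3, hx1, red_e3, mul_L01_e2]; module
    · rw [hx3, red_e1, mul_L00_e3, mul_L11_e3]; module
  have d4 : (D x4 : Wtwo F) = 0 := by
    refine kill x4 x3 w 1 0 3 (by norm_num) ?_ ?_ ?_ d3 h2'
    · rw [hx4, hx3, mul_L10_e4]
    · rw [hx4, mul_e4_left, zero_smul]
    · rw [hx4, red_e1, mul_L00_e4, mul_L11_e4]; module
  have d6 : (D x6 : Wtwo F) = 0 := by
    refine kill x6 x5 x1 (-1) 1 1 (by norm_num) ?_ ?_ ?_ d5 d1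
    · rw [hx6, hx5, mul_L10_e6]
    · rw [hx6, hx1, red_e6, mul_L01_e2]
    · rw [hx6, red_e1, mul_L00_e6, mul_L11_e6]; module
  ext1 x
  obtain ⟨a, b, c, d, e, f, hx⟩ := mem_W2_iff.1 x.2
  have hx' : x = a • x1 + b • w + c • x3 + d • x4 + e • x5 + f • x6 :=
    Subtype.ext (by simpa [hw, hx1, hx3, hx4, hx5, hx6] using hx)
  rw [Submodule.coe_eq_zero] at d1 d3 d4 d5 d6
  simp [hx', d1, h2, d3, d4, d5, d6]

/-- Every 2-local derivation of the algebra `W2` is a derivation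
(in particular, it is linear). -/
theorem every_twoLocalDerivation_isDerivation_W2 {F : Type*} [Field F] [CharZero F]
    (Δ : W2 F → W2 F)
    (hΔ : ∀ x y : W2 F, ∃ D : W2 F →ₗ[F] W2 F,
      IsDerivationW2 D ∧ Δ x = D x ∧ Δ y = D y) :
    ∃ D : W2 F →ₗ[F] W2 F, IsDerivationW2 D ∧ ∀ z : W2 F, Δ z = D z := by
  have he : e2 F ∈ W2 F := Submodule.subset_span (by simp)
  obtain ⟨D, hD, hΔD, -⟩ := hΔ ⟨e2 F, he⟩ ⟨e2 F, he⟩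
  refine ⟨D, hD, fun z => ?_⟩
  obtain ⟨D', hD', hΔD', hz⟩ := hΔ ⟨e2 F, he⟩ z
  have h : D' = D := sub_eq_zero.1 <| (hD'.sub hD).eq_zero (w := ⟨e2 F, he⟩) rfl (by
    rw [LinearMap.sub_apply, ← hΔD, ← hΔD', sub_self])
  rw [hz, h]
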